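/- (Coding theorem, converse) For any n and any random variables W₁, …, W_n on a finite alphabet 𝒲 with |𝒲| ≤ M such that Y_i–X_i–W_i is a Markov chain for each i (with (Y_i,X_i) i.i.d. ∼ P_{Y,X}), one has (1/n) Σ_{i=1}^n I(Y_i;W_i) ≤ \bar I_{α,M}( (1/n) Σ_{i=1}^n H_α(W_i) ). Consequently, any achievable Rényi entropy-relevance pair (γ, η) satisfies η ≤ \bar I_{α,M}(γ). -/

import Mathlib

open Real BigOperators Filter

noncomputable section

/-- Base-2 Shannon entropy of a probability vector on a finite alphabet. -/
def shEnt {I : Type} [Fintype I] (P : I → ℝ) : ℝ := -∑ i, P i * Real.logb 2 (P i)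

/-- Rényi entropy of order `α` (base 2) of a probability vector. -/
def renyiEnt {I : Type} [Fintype I] (α : ℝ) (P : I → ℝ) : ℝ :=
  (1 - α)⁻¹ * Real.logb 2 (∑ i, P i ^ α)

open Classical in
/-- Entropy of order `α`, where `α = 1` is understood as Shannon entropy. -/
def entOrd {I : Type} [Fintype I] (α : ℝ) (P : I → ℝ) : ℝ :=
  if α = 1 then shEnt P else renyiEnt α P

/-- `p` is a joint pmf on `Y × X`. -/
def IsJointPmf {Y X : Type} [Fintype Y] [Fintype X] (p : Y → X → ℝ) : Prop :=
  (∀ y x, 0 ≤ p y x) ∧ ∑ y, ∑ x, p y x = 1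

/-- `q` is a channel (conditional pmf) from `X` to `W`. -/
def IsKernel {X W : Type} [Fintype X] [Fintype W] (q : X → W → ℝ) : Prop :=
  (∀ x w, 0 ≤ q x w) ∧ ∀ x, ∑ w, q x w = 1

def margX {Y X : Type} [Fintype Y] [Fintype X] (p : Y → X → ℝ) (x : X) : ℝ := ∑ y, p y x

def margY {Y X : Type} [Fintype Y] [Fintype X] (p : Y → X → ℝ) (y : Y) : ℝ := ∑ x, p y x

/-- Marginal of `W` when `W` is generated from `X` through the channel `q`. -/
def margW {Y X W : Type} [Fintype Y] [Fintype X] [Fintype W]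
    (p : Y → X → ℝ) (q : X → W → ℝ) (w : W) : ℝ := ∑ x, margX p x * q x w

/-- Joint pmf of `(Y, W)` under the Markov chain `Y - X - W`. -/
def jointYW {Y X W : Type} [Fintype Y] [Fintype X] [Fintype W]
    (p : Y → X → ℝ) (q : X → W → ℝ) (y : Y) (w : W) : ℝ := ∑ x, p y x * q x w

/-- Joint pmf of `(X, W)`. -/
def jointXW {Y X W : Type} [Fintype Y] [Fintype X] [Fintype W]
    (p : Y → X → ℝ) (q : X → W → ℝ) (x : X) (w : W) : ℝ := margX p x * q x w

/-- Mutual information (base 2) of a joint pmf on `A × B`. -/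
def mi2 {A B : Type} [Fintype A] [Fintype B] (r : A → B → ℝ) : ℝ :=
  shEnt (fun a => ∑ b, r a b) + shEnt (fun b => ∑ a, r a b)
    - shEnt (fun ab : A × B => r ab.1 ab.2)

/-- `I(Y;W)` under the Markov chain `Y - X - W`. -/
def miYW {Y X W : Type} [Fintype Y] [Fintype X] [Fintype W]
    (p : Y → X → ℝ) (q : X → W → ℝ) : ℝ := mi2 (jointYW p q)

/-- `I(Y;X)`. -/
def miYX {Y X : Type} [Fintype Y] [Fintype X] (p : Y → X → ℝ) : ℝ := mi2 p

/-- `I(X;W)`. -/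
def miXW {Y X W : Type} [Fintype Y] [Fintype X] [Fintype W]
    (p : Y → X → ℝ) (q : X → W → ℝ) : ℝ := mi2 (jointXW p q)

/-- The bottleneck function `F_{α,M}(γ)`: maximal relevance `I(Y;W)` over channels
`P_{W|X}` with output alphabet of size (at most) `M` satisfying `H_α(W) ≤ γ`. -/
def Ffun {Y X : Type} [Fintype Y] [Fintype X] (p : Y → X → ℝ) (M : ℕ) (α γ : ℝ) : ℝ :=
  sSup {v | ∃ q : X → Fin M → ℝ, IsKernel q ∧ entOrd α (margW p q) ≤ γ ∧ v = miYW p q}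

/-- Upper concave envelope on `[0,∞)` via two-point convex combinations. -/
def env (F : ℝ → ℝ) (γ : ℝ) : ℝ :=
  sSup {v | ∃ t γ₁ γ₂ : ℝ, 0 ≤ t ∧ t ≤ 1 ∧ 0 ≤ γ₁ ∧ 0 ≤ γ₂ ∧
    t * γ₁ + (1 - t) * γ₂ = γ ∧ v = t * F γ₁ + (1 - t) * F γ₂}

/-- The information bottleneck function `\bar I_IB(r)`. -/
def IBfun {Y X : Type} [Fintype Y] [Fintype X] (p : Y → X → ℝ) (r : ℝ) : ℝ :=
  sSup {v | ∃ (m : ℕ) (q : X → Fin m → ℝ), IsKernel q ∧ miXW p q ≤ r ∧ v = miYW p q}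

/-- The i.i.d. joint pmf of `(Yⁿ, Xⁿ)`. -/
def iidP {Y X : Type} [Fintype Y] [Fintype X] (p : Y → X → ℝ) (n : ℕ)
    (yn : Fin n → Y) (xn : Fin n → X) : ℝ := ∏ i, p (yn i) (xn i)

open Classical in
/-- Joint pmf of `(Y_i, W_i)` when `Wⁿ` is produced from `Xⁿ` by the (possibly randomized)
code `Q` and `(Yⁿ, Xⁿ)` is i.i.d. with per-letter law `p`. -/
def pairYW {Y X W : Type} [Fintype Y] [Fintype X] [Fintype W]
    (p : Y → X → ℝ) (n : ℕ) (Q : (Fin n → X) → (Fin n → W) → ℝ) (i : Fin n)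
    (y : Y) (w : W) : ℝ :=
  ∑ yn : Fin n → Y, ∑ xn : Fin n → X, ∑ wn : Fin n → W,
    iidP p n yn xn * Q xn wn * (if yn i = y ∧ wn i = w then 1 else 0)

/-- Average per-letter output Rényi entropy `γ_n = (1/n) ∑ H_α(W_i)` of a code. -/
def avgRenyi {Y X W : Type} [Fintype Y] [Fintype X] [Fintype W]
    (p : Y → X → ℝ) (n : ℕ) (Q : (Fin n → X) → (Fin n → W) → ℝ) (α : ℝ) : ℝ :=
  (1 / (n : ℝ)) * ∑ i : Fin n, renyiEnt α (fun w => ∑ y, pairYW p n Q i y w)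

/-- Average per-letter relevance `η_n = (1/n) ∑ I(Y_i; W_i)` of a code. -/
def avgRel {Y X W : Type} [Fintype Y] [Fintype X] [Fintype W]
    (p : Y → X → ℝ) (n : ℕ) (Q : (Fin n → X) → (Fin n → W) → ℝ) : ℝ :=
  (1 / (n : ℝ)) * ∑ i : Fin n, mi2 (pairYW p n Q i)

/-- A Rényi entropy-relevance pair `(γ, η)` is achievable if some sequence of
(possibly randomized) codes `Φⁿ : 𝒳ⁿ → 𝒲ⁿ`, `|𝒲| ≤ M`, has
`limsup γ_n ≤ γ` and `liminf η_n ≥ η`. -/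
def Achievable {Y X : Type} [Fintype Y] [Fintype X]
    (p : Y → X → ℝ) (M : ℕ) (α γ η : ℝ) : Prop :=
  ∃ Q : (n : ℕ) → (Fin n → X) → (Fin n → Fin M) → ℝ,
    (∀ n, IsKernel (Q n)) ∧
    Filter.limsup (fun n => avgRenyi p n (Q n) α) Filter.atTop ≤ γ ∧
    η ≤ Filter.liminf (fun n => avgRel p n (Q n)) Filter.atTop

/-- The achievable Rényi entropy-relevance region: the closure of all achievable pairs. -/
def Region {Y X : Type} [Fintype Y] [Fintype X]
    (p : Y → X → ℝ) (M : ℕ) (α : ℝ) : Set (ℝ × ℝ) :=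
  closure {z : ℝ × ℝ | 0 ≤ z.1 ∧ 0 ≤ z.2 ∧ Achievable p M α z.1 z.2}

/-- `I_{α,M}(γ)`: the maximal achievable relevance at Rényi entropy cost `γ`. -/
def Irel {Y X : Type} [Fintype Y] [Fintype X]
    (p : Y → X → ℝ) (M : ℕ) (α γ : ℝ) : ℝ :=
  sSup {η | (γ, η) ∈ Region p M α}

/-- Mutual information is at most the entropy of a marginal: `I(A;B) ≤ H(B)`. -/
theorem mi2_le_shEnt_right {A B : Type} [Fintype A] [Fintype B] {r : A → B → ℝ}
    (hr : ∀ a b, 0 ≤ r a b) : mi2 r ≤ shEnt (fun b => ∑ a, r a b) := by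
  have key : ∑ ab : A × B, r ab.1 ab.2 * logb 2 (r ab.1 ab.2)
      ≤ ∑ a, (∑ b, r a b) * logb 2 (∑ b, r a b) := by
    rw [Fintype.sum_prod_type]
    refine Finset.sum_le_sum fun a _ => ?_
    rw [Finset.sum_mul]
    refine Finset.sum_le_sum fun b _ => ?_
    rcases (hr a b).eq_or_lt with h | h
    · simp [← h]
    · exact mul_le_mul_of_nonneg_left (logb_le_logb_of_le one_lt_two h
        (Finset.single_le_sum (fun b _ => hr a b) (Finset.mem_univ b))) h.le
  simp only [mi2, shEnt]
  linarith

/-- Gibbs' inequality: mutual information is nonnegative. -/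
theorem mi2_nonneg {A B : Type} [Fintype A] [Fintype B] {r : A → B → ℝ}
    (hr : ∀ a b, 0 ≤ r a b) (h1 : ∑ a, ∑ b, r a b = 1) : 0 ≤ mi2 r := by
  have hl2 : 0 < log 2 := log_pos one_lt_two
  have term : ∀ a b, r a b - (∑ b', r a b') * (∑ a', r a' b) ≤
      r a b * log (r a b) - r a b * log (∑ b', r a b') - r a b * log (∑ a', r a' b) := by
    intro a b
    have hu : r a b ≤ ∑ b', r a b' :=
      Finset.single_le_sum (fun b _ => hr a b) (Finset.mem_univ b)
    have hv : r a b ≤ ∑ a', r a' b :=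
      Finset.single_le_sum (f := fun a' => r a' b) (fun a _ => hr a b) (Finset.mem_univ a)
    generalize (∑ b', r a b') = u at *
    generalize (∑ a', r a' b) = v at *
    rcases (hr a b).eq_or_lt with h | h
    · rw [← h] at hu hv ⊢
      simpa using mul_nonneg hu hv
    · have hu0 : 0 < u := h.trans_le hu
      have hv0 : 0 < v := h.trans_le hv
      have := log_le_sub_one_of_pos (div_pos (mul_pos hu0 hv0) h)
      rw [log_div (by positivity) h.ne', log_mul hu0.ne' hv0.ne'] at this
      have h2 := mul_le_mul_of_nonneg_left this h.le
      have h3 : r a b * (u * v / r a b - 1) = u * v - r a b := by field_simp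
      rw [h3] at h2
      linarith
  have hsum := Finset.sum_le_sum fun a (_ : a ∈ Finset.univ) =>
    Finset.sum_le_sum fun b (_ : b ∈ Finset.univ) => term a b
  have hprod : ∑ a, ∑ b, (∑ b', r a b') * (∑ a', r a' b) = 1 := by
    simp_rw [← Finset.mul_sum]
    rw [← Finset.sum_mul, Finset.sum_comm (f := fun b a => r a b), h1, one_mul]
  have hA : ∑ a, ∑ b, r a b * log (∑ b', r a b')
      = ∑ a, (∑ b, r a b) * log (∑ b, r a b) := by simp_rw [Finset.sum_mul]
  have hB : ∑ a, ∑ b, r a b * log (∑ a', r a' b)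
      = ∑ b, (∑ a, r a b) * log (∑ a, r a b) := by
    rw [Finset.sum_comm]; simp_rw [Finset.sum_mul]
  simp only [Finset.sum_sub_distrib, hprod, h1, hA, hB, sub_self] at hsum
  have heq : mi2 r = (∑ a, ∑ b, r a b * log (r a b)
      - ∑ a, (∑ b, r a b) * log (∑ b, r a b)
      - ∑ b, (∑ a, r a b) * log (∑ a, r a b)) / log 2 := by
    simp only [mi2, shEnt, Fintype.sum_prod_type, logb, mul_div_assoc', ← Finset.sum_div]
    ring
  rw [heq]
  positivity

theorem sum_rpow_pos {I : Type} [Fintype I] {P : I → ℝ} (hP : ∀ i, 0 ≤ P i)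
    (h1 : ∑ i, P i = 1) (α : ℝ) : 0 < ∑ i, P i ^ α := by
  obtain ⟨i, -, hi⟩ : ∃ i ∈ Finset.univ, P i ≠ 0 :=
    Finset.exists_ne_zero_of_sum_ne_zero (by rw [h1]; exact one_ne_zero)
  exact Finset.sum_pos' (fun i _ => rpow_nonneg (hP i) α)
    ⟨i, Finset.mem_univ i, rpow_pos_of_pos ((hP i).lt_of_ne' hi) α⟩

/-- Rényi entropy of order less than one dominates Shannon entropy. -/
theorem shEnt_le_renyiEnt {I : Type} [Fintype I] {P : I → ℝ} (hP : ∀ i, 0 ≤ P i)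
    (h1 : ∑ i, P i = 1) {α : ℝ} (hα0 : 0 < α) (hα1 : α < 1) :
    shEnt P ≤ renyiEnt α P := by
  have hS := sum_rpow_pos hP h1 α
  have hl2 : 0 < log 2 := log_pos one_lt_two
  simp only [shEnt, renyiEnt]
  set S := ∑ i, P i ^ α with hSdef
  have term : ∀ i, (α - 1) * (P i * log (P i)) - P i * log S ≤ P i ^ α / S - P i := by
    intro i
    rcases (hP i).eq_or_lt with h | h
    · simp [← h, zero_rpow hα0.ne']
    · have hpow : 0 < P i ^ (α - 1) := rpow_pos_of_pos h _
      have := log_le_sub_one_of_pos (div_pos hpow hS)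
      rw [log_div hpow.ne' hS.ne', log_rpow h] at this
      have h2 := mul_le_mul_of_nonneg_left this h.le
      have h3 : P i ^ α = P i * P i ^ (α - 1) := by
        rw [rpow_sub_one h.ne']; field_simp
      rw [h3]
      calc _ = P i * ((α - 1) * log (P i) - log S) := by ring
        _ ≤ _ := h2
        _ = _ := by ring
  have hsum := Finset.sum_le_sum fun i (_ : i ∈ Finset.univ) => term i
  simp only [Finset.sum_sub_distrib, ← Finset.mul_sum, ← Finset.sum_mul, ← Finset.sum_div,
    ← hSdef, h1, div_self hS.ne', sub_self, one_mul] at hsum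
  have hα : 0 < 1 - α := sub_pos.2 hα1
  simp only [logb, mul_div_assoc', ← Finset.sum_div]
  rw [← neg_div]
  refine div_le_div_of_nonneg_right ?_ hl2.le
  rw [inv_mul_eq_div, le_div_iff₀ hα]
  linarith

theorem renyiEnt_le_card {I : Type} [Fintype I] {P : I → ℝ} (hP : ∀ i, 0 ≤ P i)
    (h1 : ∑ i, P i = 1) {α : ℝ} (hα0 : 0 < α) (hα1 : α < 1) :
    renyiEnt α P ≤ (1 - α)⁻¹ * logb 2 (Fintype.card I) := by
  refine mul_le_mul_of_nonneg_left (logb_le_logb_of_le one_lt_two (sum_rpow_pos hP h1 α) ?_)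
    (inv_nonneg.2 (sub_pos.2 hα1).le)
  calc ∑ i, P i ^ α ≤ ∑ _i : I, (1 : ℝ) := Finset.sum_le_sum fun i _ =>
        rpow_le_one (hP i)
          (h1 ▸ Finset.single_le_sum (fun i _ => hP i) (Finset.mem_univ i)) hα0.le
    _ = _ := by simp

section Markov

variable {Y X W : Type} [Fintype Y] [Fintype X] [Fintype W] {p : Y → X → ℝ} {q : X → W → ℝ}

theorem margX_nonneg (hp : IsJointPmf p) (x : X) : 0 ≤ margX p x :=
  Finset.sum_nonneg fun y _ => hp.1 y x

theorem sum_margX (hp : IsJointPmf p) : ∑ x, margX p x = 1 := by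
  simp only [margX]; rw [Finset.sum_comm]; exact hp.2

theorem jointYW_nonneg (hp : IsJointPmf p) (hq : IsKernel q) (y : Y) (w : W) :
    0 ≤ jointYW p q y w :=
  Finset.sum_nonneg fun x _ => mul_nonneg (hp.1 y x) (hq.1 x w)

theorem sum_jointYW_left (p : Y → X → ℝ) (q : X → W → ℝ) :
    (fun w => ∑ y, jointYW p q y w) = margW p q := by
  funext w
  simp only [jointYW, margW, margX, Finset.sum_mul]
  exact Finset.sum_comm

theorem margW_nonneg (hp : IsJointPmf p) (hq : IsKernel q) (w : W) : 0 ≤ margW p q w :=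
  Finset.sum_nonneg fun x _ => mul_nonneg (margX_nonneg hp x) (hq.1 x w)

theorem sum_margW (hp : IsJointPmf p) (hq : IsKernel q) : ∑ w, margW p q w = 1 := by
  simp only [margW]
  rw [Finset.sum_comm]
  simp only [← Finset.mul_sum, hq.2, mul_one]
  exact sum_margX hp

theorem miYW_nonneg (hp : IsJointPmf p) (hq : IsKernel q) : 0 ≤ miYW p q := by
  refine mi2_nonneg (jointYW_nonneg hp hq) ?_
  rw [Finset.sum_comm]
  exact (congrArg (fun f => ∑ w, f w) (sum_jointYW_left p q)).trans (sum_margW hp hq)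

theorem miYW_le_renyiEnt (hp : IsJointPmf p) (hq : IsKernel q) {α : ℝ} (hα0 : 0 < α)
    (hα1 : α < 1) : miYW p q ≤ renyiEnt α (margW p q) := by
  refine (mi2_le_shEnt_right (jointYW_nonneg hp hq)).trans ?_
  rw [sum_jointYW_left]
  exact shEnt_le_renyiEnt (margW_nonneg hp hq) (sum_margW hp hq) hα0 hα1

end Markov

section Bottleneck

variable {Y X : Type} [Fintype Y] [Fintype X] {p : Y → X → ℝ} {M : ℕ} {α : ℝ}

theorem Ffun_nonneg (hp : IsJointPmf p) (γ : ℝ) : 0 ≤ Ffun p M α γ := by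
  refine Real.sSup_nonneg ?_
  rintro v ⟨q, hq, -, rfl⟩
  exact miYW_nonneg hp hq

theorem Ffun_le_self (hp : IsJointPmf p) (hα0 : 0 < α) (hα1 : α < 1) {γ : ℝ} (hγ : 0 ≤ γ) :
    Ffun p M α γ ≤ γ := by
  refine Real.sSup_le ?_ hγ
  rintro v ⟨q, hq, hle, rfl⟩
  rw [entOrd, if_neg hα1.ne] at hle
  exact (miYW_le_renyiEnt hp hq hα0 hα1).trans hle

theorem miYW_le_Ffun (hp : IsJointPmf p) (hα0 : 0 < α) (hα1 : α < 1)
    {q : X → Fin M → ℝ} (hq : IsKernel q) :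
    miYW p q ≤ Ffun p M α (renyiEnt α (margW p q)) := by
  refine le_csSup ⟨renyiEnt α (margW p q), ?_⟩ ⟨q, hq, ?_, rfl⟩
  · rintro v ⟨q', hq', hle, rfl⟩
    rw [entOrd, if_neg hα1.ne] at hle
    exact (miYW_le_renyiEnt hp hq' hα0 hα1).trans hle
  · rw [entOrd, if_neg hα1.ne]

end Bottleneck

/-- A function on `[0,∞)` lying between `0` and the identity is dominated by a line of
nonnegative slope that meets its two-point concave envelope at any prescribed `m ≥ 0`. -/
theorem exists_slope_le_env {F : ℝ → ℝ} (hF0 : ∀ x, 0 ≤ x → 0 ≤ F x)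
    (hF : ∀ x, 0 ≤ x → F x ≤ x) {m : ℝ} (hm : 0 ≤ m) :
    ∃ s, 0 ≤ s ∧ ∀ x, 0 ≤ x → F x ≤ env F m + s * (x - m) := by
  have two : ∀ t a b : ℝ, 0 ≤ t → t ≤ 1 → 0 ≤ a → 0 ≤ b → t * a + (1 - t) * b = m →
      t * F a + (1 - t) * F b ≤ env F m := by
    intro t a b h0 h1 ha hb hab
    refine le_csSup ⟨m, ?_⟩ ⟨t, a, b, h0, h1, ha, hb, hab, rfl⟩
    rintro v ⟨t, a, b, h0, h1, ha, hb, rfl, rfl⟩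
    have := mul_le_mul_of_nonneg_left (hF a ha) h0
    have := mul_le_mul_of_nonneg_left (hF b hb) (sub_nonneg.2 h1)
    linarith
  have hFm : F m ≤ env F m := by
    simpa using two 1 m m zero_le_one le_rfl hm hm (by ring)
  set c := env F m
  have hc : 0 ≤ c := (hF0 m hm).trans hFm
  rcases hm.eq_or_lt with rfl | hm0
  · exact ⟨1, zero_le_one, fun x hx => by linarith [hF x hx]⟩
  have cross : ∀ a b, 0 ≤ a → a < m → m < b → (F b - c) / (b - m) ≤ (c - F a) / (m - a) := by
    intro a b ha ham hmb
    have hba : 0 < b - a := by linarith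
    have h := two ((b - m) / (b - a)) a b (div_nonneg (by linarith) hba.le)
      ((div_le_one hba).2 (by linarith)) ha (by linarith) (by field_simp; ring)
    have h2 : (b - m) * F a + (m - a) * F b ≤ c * (b - a) := by
      have := mul_le_mul_of_nonneg_right h hba.le
      calc _ = ((b - m) / (b - a) * F a + (1 - (b - m) / (b - a)) * F b) * (b - a) := by
            field_simp; ring
        _ ≤ _ := this
    rw [div_le_div_iff₀ (by linarith) (by linarith)]
    linarith
  set s := sSup ((fun b => (F b - c) / (b - m)) '' Set.Ioi m)
  have hne : ((fun b => (F b - c) / (b - m)) '' Set.Ioi m).Nonempty := Set.nonempty_Ioi.image _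
  have hbdd : BddAbove ((fun b => (F b - c) / (b - m)) '' Set.Ioi m) := by
    refine ⟨(c - F 0) / (m - 0), ?_⟩
    rintro _ ⟨b, hb, rfl⟩
    exact cross 0 b le_rfl hm0 hb
  have line : ∀ x, 0 ≤ x → F x ≤ c + s * (x - m) := by
    intro x hx
    rcases lt_trichotomy x m with h | rfl | h
    · have : s ≤ (c - F x) / (m - x) := by
        refine csSup_le hne ?_
        rintro _ ⟨b, hb, rfl⟩
        exact cross x b hx h hb
      rw [le_div_iff₀ (by linarith)] at this
      linarith
    · simpa using hFm
    · have : (F x - c) / (x - m) ≤ s := le_csSup hbdd ⟨x, h, rfl⟩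
      rw [div_le_iff₀ (by linarith)] at this
      linarith
  refine ⟨s, ?_, line⟩
  by_contra! hs
  have h1 : 0 ≤ m + (c + 1) / (-s) :=
    add_nonneg hm (div_nonneg (by linarith) (by linarith))
  have h2 := (hF0 _ h1).trans (line _ h1)
  have h3 : s * (m + (c + 1) / (-s) - m) = -(c + 1) := by
    field_simp [hs.ne]; ring
  linarith

section SingleLetter

variable {Y X W : Type} [Fintype Y] [Fintype X] [Fintype W]

open Classical in
/-- The channel from the `i`-th input letter to the `i`-th output letter induced by a block
code, the remaining input letters being drawn independently from `margX p`. -/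
def letterKernel (p : Y → X → ℝ) {n : ℕ} (Q : (Fin n → X) → (Fin n → W) → ℝ) (i : Fin n)
    (x : X) (w : W) : ℝ :=
  ∑ xn : Fin n → X, ∑ wn : Fin n → W,
    (∏ j, if j = i then (if xn j = x then 1 else 0) else margX p (xn j)) * Q xn wn *
      (if wn i = w then 1 else 0)

theorem isKernel_letterKernel {p : Y → X → ℝ} (hp : IsJointPmf p) {n : ℕ}
    {Q : (Fin n → X) → (Fin n → W) → ℝ} (hQ : IsKernel Q) (i : Fin n) :
    IsKernel (letterKernel p Q i) := by
  classical
  constructor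
  · intro x w
    refine Finset.sum_nonneg fun xn _ => Finset.sum_nonneg fun wn _ => mul_nonneg
      (mul_nonneg (Finset.prod_nonneg fun j _ => ?_) (hQ.1 xn wn)) (by split_ifs <;> simp)
    split_ifs
    · exact zero_le_one
    · exact le_rfl
    · exact margX_nonneg hp _
  · intro x
    simp only [letterKernel]
    rw [Finset.sum_comm]
    have : ∀ xn : Fin n → X, (∑ w, ∑ wn : Fin n → W,
        (∏ j, if j = i then (if xn j = x then (1 : ℝ) else 0) else margX p (xn j)) * Q xn wn *
          (if wn i = w then 1 else 0))
        = ∏ j, if j = i then (if xn j = x then (1 : ℝ) else 0) else margX p (xn j) := by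
      intro xn
      rw [Finset.sum_comm]
      simp only [← Finset.mul_sum, Finset.sum_ite_eq, Finset.mem_univ, if_true, mul_one, hQ.2]
    simp only [this]
    rw [← Fintype.prod_sum
      (fun (j : Fin n) x' => if j = i then (if x' = x then (1 : ℝ) else 0) else margX p x')]
    refine Finset.prod_eq_one fun j _ => ?_
    by_cases h : j = i
    · simp [h]
    · simp [h, sum_margX hp]

/-- Single-letterization: the law of `(Y_i, W_i)` is that of a Markov chain
`Y - X - W` through `letterKernel`. -/
theorem pairYW_eq_jointYW (p : Y → X → ℝ) {n : ℕ} (Q : (Fin n → X) → (Fin n → W) → ℝ)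
    (i : Fin n) : pairYW p n Q i = jointYW p (letterKernel p Q i) := by
  classical
  funext y w
  have hyn : ∀ xn : Fin n → X,
      ∑ yn : Fin n → Y, iidP p n yn xn * (if yn i = y then 1 else 0)
        = ∑ x, p y x *
          ∏ j, if j = i then (if xn j = x then 1 else 0) else margX p (xn j) := by
    intro xn
    have hl : ∀ yn : Fin n → Y, iidP p n yn xn * (if yn i = y then 1 else 0)
        = ∏ j, if j = i then (if yn j = y then p (yn j) (xn j) else 0)
            else p (yn j) (xn j) := by
      intro yn
      rw [iidP, ← Finset.mul_prod_erase _ _ (Finset.mem_univ i),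
        ← Finset.mul_prod_erase _ _ (Finset.mem_univ i), if_pos rfl]
      have : ∏ j ∈ Finset.univ.erase i,
          (if j = i then (if yn j = y then p (yn j) (xn j) else 0) else p (yn j) (xn j))
          = ∏ j ∈ Finset.univ.erase i, p (yn j) (xn j) :=
        Finset.prod_congr rfl fun j hj => if_neg (Finset.ne_of_mem_erase hj)
      rw [this]
      split_ifs <;> ring
    have hr : ∀ x, (∏ j, if j = i then (if xn j = x then (1 : ℝ) else 0) else margX p (xn j))
        = (if xn i = x then 1 else 0) * ∏ j ∈ Finset.univ.erase i, margX p (xn j) := by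
      intro x
      rw [← Finset.mul_prod_erase _ _ (Finset.mem_univ i), if_pos rfl]
      congr 1
      exact Finset.prod_congr rfl fun j hj => if_neg (Finset.ne_of_mem_erase hj)
    simp only [hl, hr]
    rw [← Fintype.prod_sum (fun (j : Fin n) y' =>
      if j = i then (if y' = y then p y' (xn j) else 0) else p y' (xn j)),
      ← Finset.mul_prod_erase _ _ (Finset.mem_univ i)]
    have : ∏ j ∈ Finset.univ.erase i, (∑ y', if j = i then
        (if y' = y then p y' (xn j) else 0) else p y' (xn j))
        = ∏ j ∈ Finset.univ.erase i, margX p (xn j) :=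
      Finset.prod_congr rfl fun j hj => by simp [Finset.ne_of_mem_erase hj, margX]
    rw [this]
    simp
  have hpair : pairYW p n Q i y w = ∑ xn : Fin n → X, ∑ wn : Fin n → W,
      (∑ yn : Fin n → Y, iidP p n yn xn * (if yn i = y then 1 else 0)) *
        (Q xn wn * if wn i = w then 1 else 0) := by
    simp only [pairYW, Finset.sum_mul]
    rw [Finset.sum_comm]
    refine Finset.sum_congr rfl fun xn _ => ?_
    rw [Finset.sum_comm]
    refine Finset.sum_congr rfl fun wn _ => Finset.sum_congr rfl fun yn _ => ?_
    by_cases h1 : yn i = y <;> by_cases h2 : wn i = w <;> simp [h1, h2]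
  rw [hpair]
  simp only [hyn, jointYW, letterKernel, Finset.sum_mul, Finset.mul_sum]
  symm
  rw [Finset.sum_comm]
  refine Finset.sum_congr rfl fun xn _ => ?_
  rw [Finset.sum_comm]
  refine Finset.sum_congr rfl fun wn _ => Finset.sum_congr rfl fun x _ => ?_
  ring

end SingleLetter

/-- Averaging an affine bound of the per-letter relevances. -/
theorem average_le_line {n : ℕ} (hn : 0 < n) {u v : Fin n → ℝ} {c s m : ℝ}
    (h : ∀ i, u i ≤ c + s * (v i - m)) :
    (1 / (n : ℝ)) * ∑ i, u i ≤ c + s * ((1 / (n : ℝ)) * ∑ i, v i - m) := by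
  have hn' : (0 : ℝ) < n := Nat.cast_pos.2 hn
  calc (1 / (n : ℝ)) * ∑ i, u i ≤ (1 / (n : ℝ)) * ∑ i, (c + s * (v i - m)) :=
        mul_le_mul_of_nonneg_left (Finset.sum_le_sum fun i _ => h i) (by positivity)
    _ = _ := by
        simp only [Finset.sum_add_distrib, ← Finset.mul_sum, Finset.sum_sub_distrib,
          Finset.sum_const, Finset.card_univ, Fintype.card_fin, nsmul_eq_mul]
        field_simp

/-- coding theorem, converse: for any `n ≥ 1` and any `W₁, …, W_n` with
`Y_i – X_i – W_i`, one has `(1/n) ∑ I(Y_i;W_i) ≤ \bar I_{α,M}((1/n) ∑ H_α(W_i))`;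
consequently every achievable pair `(γ, η)` satisfies `η ≤ \bar I_{α,M}(γ)`. -/
theorem stmt12 {Y X : Type} [Fintype Y] [Fintype X]
    (p : Y → X → ℝ) (hp : IsJointPmf p)
    (M : ℕ) (hM : 0 < M) (α : ℝ) (hα0 : 0 < α) (hα1 : α < 1) :
    (∀ (n : ℕ), 0 < n → ∀ q : Fin n → X → Fin M → ℝ, (∀ i, IsKernel (q i)) →
      (1 / (n : ℝ)) * ∑ i, miYW p (q i)
        ≤ env (Ffun p M α) ((1 / (n : ℝ)) * ∑ i, renyiEnt α (margW p (q i)))) ∧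
    (∀ γ η : ℝ, 0 ≤ γ → 0 ≤ η → Achievable p M α γ η → η ≤ env (Ffun p M α) γ) := by
  have slope := fun m hm => exists_slope_le_env (F := Ffun p M α)
    (fun x _ => Ffun_nonneg hp x) (fun x hx => Ffun_le_self hp hα0 hα1 hx) (m := m) hm
  have hren : ∀ q : X → Fin M → ℝ, IsKernel q → 0 ≤ renyiEnt α (margW p q) := fun q hq =>
    (miYW_nonneg hp hq).trans (miYW_le_renyiEnt hp hq hα0 hα1)
  constructor
  · intro n hn q hq
    obtain ⟨s, -, hs⟩ := slope ((1 / (n : ℝ)) * ∑ i, renyiEnt α (margW p (q i)))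
      (mul_nonneg (by positivity) (Finset.sum_nonneg fun i _ => hren _ (hq i)))
    have h := average_le_line hn (u := fun i => miYW p (q i))
      (v := fun i => renyiEnt α (margW p (q i))) fun i =>
        (miYW_le_Ffun hp hα0 hα1 (hq i)).trans (hs _ (hren _ (hq i)))
    simpa using h
  · rintro γ η hγ - ⟨Q, hQ, hsup, hinf⟩
    obtain ⟨s, hs0, hs⟩ := slope γ hγ
    have hk : ∀ n i, IsKernel (letterKernel p (Q n) i) := fun n i =>
      isKernel_letterKernel hp (hQ n) i
    have hRel : ∀ n, avgRel p n (Q n) =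
        (1 / (n : ℝ)) * ∑ i, miYW p (letterKernel p (Q n) i) := fun n => by
      simp only [avgRel, miYW, pairYW_eq_jointYW]
    have hRen : ∀ n, avgRenyi p n (Q n) α =
        (1 / (n : ℝ)) * ∑ i, renyiEnt α (margW p (letterKernel p (Q n) i)) := fun n => by
      simp only [avgRenyi, pairYW_eq_jointYW, sum_jointYW_left]
    have hbelow : IsBoundedUnder (· ≥ ·) atTop fun n => avgRel p n (Q n) :=
      isBoundedUnder_of ⟨0, fun n => by
        rw [hRel]
        exact mul_nonneg (by positivity) (Finset.sum_nonneg fun i _ => miYW_nonneg hp (hk n i))⟩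
    have habove : IsBoundedUnder (· ≤ ·) atTop fun n => avgRenyi p n (Q n) α := by
      refine isBoundedUnder_of_eventually_le (a := (1 - α)⁻¹ * logb 2 M) ?_
      filter_upwards [eventually_gt_atTop 0] with n hn
      rw [hRen]
      have h := average_le_line hn (s := 0) (m := 0) (v := fun _ => 0)
        (c := (1 - α)⁻¹ * logb 2 M)
        (u := fun i => renyiEnt α (margW p (letterKernel p (Q n) i))) fun i => by
          simpa using renyiEnt_le_card (margW_nonneg hp (hk n i)) (sum_margW hp (hk n i)) hα0 hα1
      simpa using h
    have main : ∀ ε : ℝ, 0 < ε → η ≤ env (Ffun p M α) γ + s * ε := by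
      intro ε hε
      refine hinf.trans (liminf_le_of_frequently_le (Eventually.frequently ?_) hbelow)
      filter_upwards [eventually_gt_atTop 0,
        eventually_lt_of_limsup_lt (hsup.trans_lt (lt_add_of_pos_right γ hε)) habove]
        with n hn hlt
      have h := average_le_line hn (u := fun i => miYW p (letterKernel p (Q n) i))
        (v := fun i => renyiEnt α (margW p (letterKernel p (Q n) i))) fun i =>
          (miYW_le_Ffun hp hα0 hα1 (hk n i)).trans (hs _ (hren _ (hk n i)))
      rw [← hRel, ← hRen] at h
      exact h.trans (add_le_add le_rfl (mul_le_mul_of_nonneg_left (by linarith) hs0))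
    refine le_of_forall_pos_le_add fun δ hδ => ?_
    refine (main (δ / (s + 1)) (by positivity)).trans (add_le_add le_rfl ?_)
    rw [mul_div_assoc', div_le_iff₀ (by positivity)]
    nlinarith

end
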